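/- arXiv:1510.01645 — 8 statements merged into one kernel-verified Lean document; each statement's English description precedes it below -/
import Mathlib

section
/- Let a, b, c be positive integers such that c < a*b, a < b*c, b < c*a, and each of a*b - c, b*c - a, c*a - b is a power of 2 (i.e., equals 2^k for some nonnegative integer k). Then (a, b, c) is a permutation of one of the triples (2, 2, 2), (3, 2, 2), (11, 6, 2), (7, 5, 3). Conversely, every permutation of these four triples satisfies the hypotheses. -/
/-- A power of 2, i.e. `2^k` for some nonnegative integer `k`. -/
def IsPow2 (n : ℕ) : Prop := ∃ k : ℕ, n = 2 ^ k

theorem two_pow_dvd_of_dvd_mul_odd {k m n : ℕ} (hn : n % 2 = 1) (h : 2 ^ k ∣ m * n) :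
    2 ^ k ∣ m :=
  ((Nat.coprime_two_left.2 (Nat.odd_iff.2 hn)).pow_left k).dvd_of_dvd_mul_right h

theorem two_pow_eq_one_of_odd {k : ℕ} (h : 2 ^ k % 2 = 1) : 2 ^ k = 1 := by
  cases k with
  | zero => rfl
  | succ k => rw [pow_succ] at h; omega

theorem four_dvd_two_pow {k : ℕ} (h : 2 < 2 ^ k) : 4 ∣ 2 ^ k := by
  match k, h with
  | 0, h => simp at h
  | 1, h => simp at h
  | k + 2, _ => exact ⟨2 ^ k, by ring⟩

theorem two_pow_eq_eight_of_add_eight {x y : ℕ} (h : 2 ^ x + 8 = 2 ^ y) : 2 ^ x = 8 := by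
  have hx0 : 0 < 2 ^ x := by positivity
  by_cases hx : x ≤ 3
  · interval_cases x
    · have := four_dvd_two_pow (k := y) (by omega)
      omega
    · have := four_dvd_two_pow (k := y) (by omega)
      omega
    · have hy : 3 < y := (Nat.pow_lt_pow_iff_right (a := 2) (by norm_num)).1 (by omega)
      have : 2 ^ 4 ∣ 2 ^ y := pow_dvd_pow 2 hy
      omega
    · rfl
  · have hx' : 2 ^ 4 ∣ 2 ^ x := pow_dvd_pow 2 (by omega)
    have hy : 3 < y := (Nat.pow_lt_pow_iff_right (a := 2) (by norm_num)).1 (by omega)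
    have : 2 ^ 4 ∣ 2 ^ y := pow_dvd_pow 2 hy
    omega

/-- The case of two equal smallest entries. -/
theorem eq_of_smallest_eq {a c x y : ℕ} (ha : 2 ≤ a) (hac : a ≤ c)
    (hx : a * a = c + 2 ^ x) (hy : c * a = a + 2 ^ y) : a = 2 ∧ (c = 2 ∨ c = 3) := by
  obtain ⟨d, rfl⟩ : ∃ d, c = d + 1 := ⟨c - 1, by omega⟩
  have hda : d * a = 2 ^ y := by linarith
  obtain ⟨i, -, rfl⟩ := (Nat.dvd_prime_pow Nat.prime_two).1 (Dvd.intro_left d hda)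
  obtain ⟨j, -, rfl⟩ := (Nat.dvd_prime_pow Nat.prime_two).1 (Dvd.intro (2 ^ i) hda)
  obtain _ | i := i
  · omega
  obtain _ | j := j
  · have : 2 ^ (i + 1) = 2 := by omega
    omega
  have h1 : 2 ^ x = 1 := two_pow_eq_one_of_odd (by grind)
  have h4 : 2 ^ (i + 1) = 2 := by
    by_contra h
    have hi := four_dvd_two_pow (k := i + 1) (by omega)
    have h4 : 4 ∣ 2 ^ (i + 1) * 2 ^ (i + 1) := hi.mul_right _
    have hle : 2 ^ (j + 1) = 2 := by
      by_contra h'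
      have := four_dvd_two_pow (k := j + 1) (by omega)
      omega
    omega
  rw [h4] at hx
  omega

/-- The case of smallest entry `2`, the others being larger. -/
theorem eq_of_smallest_eq_two {b c x y z : ℕ} (hb : 2 < b) (hbc : b ≤ c)
    (hx : 2 * b = c + 2 ^ x) (hy : c * 2 = b + 2 ^ y) (hz : b * c = 2 + 2 ^ z) :
    b = 6 ∧ c = 11 := by
  have hz4 : 4 ∣ 2 ^ z := four_dvd_two_pow (by nlinarith)
  have hmod : b * c % 4 = 2 := by omega
  have hcb : c % 2 = 1 ∧ b % 2 = 0 := by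
    by_cases h : b % 2 = 1
    · have := two_pow_eq_one_of_odd (k := y) (by omega)
      omega
    · refine ⟨?_, by omega⟩
      by_contra h'
      have : 2 * 2 ∣ b * c := mul_dvd_mul (by omega) (by omega)
      omega
  have h1 := two_pow_eq_one_of_odd (k := x) (by omega)
  obtain rfl : c = 2 * b - 1 := by omega
  have hb3 : 3 * b = 2 ^ y + 2 := by omega
  have hquad : 9 * 2 ^ z + 16 = 2 ^ y * (2 * 2 ^ y + 5) := by
    zify [show 1 ≤ 2 * b by omega] at hz hb3 ⊢
    have : (2 : ℤ) ^ y = 3 * b - 2 := by linarith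
    rw [this]
    linarith
  by_cases hy5 : y < 5
  · interval_cases y <;> omega
  · have h32 : 2 ^ 5 ∣ 2 ^ y := pow_dvd_pow 2 (by omega)
    have h32' := h32.mul_right (2 * 2 ^ y + 5)
    have hz5 : z < 5 := by
      by_contra h
      have : 2 ^ 5 ∣ 2 ^ z := pow_dvd_pow 2 (by omega)
      omega
    have : 2 ^ z < 2 ^ 5 := Nat.pow_lt_pow_right (by norm_num) hz5
    have := Nat.le_of_dvd (by positivity) h32
    nlinarith

theorem two_pow_dvd_two_mul_sub_or_add {a d c y z : ℕ}
    (hy : (c + 1) * a = a + d + 2 ^ y) (hz : (a + d) * (c + 1) = a + 2 ^ z) :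
    2 ^ y ∣ 2 * d ∨ 2 ^ y ∣ 2 * (a + (a + d)) := by
  have hyz : 2 ^ y ∣ 2 ^ z :=
    pow_dvd_pow 2 ((Nat.pow_le_pow_iff_right (a := 2) (by norm_num)).1 (by nlinarith))
  have hsub : 2 ^ y ∣ d * (c + 2) :=
    (Nat.dvd_add_left (dvd_refl (2 ^ y))).1 (by rwa [show d * (c + 2) + 2 ^ y = 2 ^ z by nlinarith])
  have hadd : 2 ^ y ∣ (a + (a + d)) * c := by
    rw [show (a + (a + d)) * c = 2 ^ z + 2 ^ y by nlinarith]
    exact hyz.add (dvd_refl _)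
  by_cases h : c % 4 = 2
  · right
    refine two_pow_dvd_of_dvd_mul_odd (n := c / 2) (by omega) ?_
    rwa [mul_assoc, mul_left_comm, Nat.mul_div_cancel' (by omega)]
  · left
    by_cases h2 : c % 2 = 1
    · exact (two_pow_dvd_of_dvd_mul_odd (by omega) hsub).mul_left 2
    · refine two_pow_dvd_of_dvd_mul_odd (n := (c + 2) / 2) (by omega) ?_
      rwa [mul_assoc, mul_left_comm, Nat.mul_div_cancel' (by omega)]

/-- The case of smallest entry at least `3`, the others being larger. -/
theorem eq_of_three_le_smallest {a b c x y z : ℕ} (ha : 3 ≤ a) (hab : a < b) (hbc : b ≤ c)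
    (hx : a * b = c + 2 ^ x) (hy : c * a = b + 2 ^ y) (hz : b * c = a + 2 ^ z) :
    a = 3 ∧ b = 5 ∧ c = 7 := by
  have hlt : b ≠ c := by
    rintro rfl
    obtain ⟨e, rfl⟩ : ∃ e, a = e + 1 := ⟨a - 1, by omega⟩
    have heb : e * b = 2 ^ x := by linarith
    obtain ⟨i, -, hi⟩ := (Nat.dvd_prime_pow Nat.prime_two).1 (Dvd.intro_left e heb)
    obtain ⟨j, -, hj⟩ := (Nat.dvd_prime_pow Nat.prime_two).1 (Dvd.intro b heb)
    obtain _ | i := i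
    · omega
    obtain _ | j := j
    · omega
    have := two_pow_eq_one_of_odd (k := z) (by grind)
    nlinarith
  obtain ⟨d, rfl⟩ := Nat.exists_eq_add_of_le hab.le
  obtain ⟨e, rfl⟩ : ∃ e, c = e + 1 := ⟨c - 1, by omega⟩
  have hle : 2 ^ y ≤ 2 * (a + (a + d)) := by
    rcases two_pow_dvd_two_mul_sub_or_add hy hz with h | h
    · exact (Nat.le_of_dvd (by omega) h).trans (by omega)
    · exact Nat.le_of_dvd (by omega) h
  obtain rfl : a = 3 := by
    by_contra h
    have ha4 : 4 ≤ a := by omega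
    have hae : (a + d + 1) * a ≤ (e + 1) * a := Nat.mul_le_mul_right a (by omega)
    have had : 4 * (a + d) ≤ a * (a + d) := Nat.mul_le_mul_right _ ha4
    nlinarith
  obtain he | he : e = 3 + d ∨ e = 3 + d + 1 := by omega
  · have := two_pow_eq_one_of_odd (k := x) (by omega)
    omega
  · have := two_pow_eq_eight_of_add_eight (x := x) (y := y) (by omega)
    omega

theorem eq_of_sorted {a b c x y z : ℕ} (ha : 0 < a) (hab : a ≤ b) (hbc : b ≤ c)
    (hx : a * b = c + 2 ^ x) (hy : c * a = b + 2 ^ y) (hz : b * c = a + 2 ^ z) :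
    a = 2 ∧ b = 2 ∧ c = 2 ∨ a = 2 ∧ b = 2 ∧ c = 3 ∨ a = 2 ∧ b = 6 ∧ c = 11 ∨
      a = 3 ∧ b = 5 ∧ c = 7 := by
  have hx0 : 0 < 2 ^ x := by positivity
  have ha2 : 2 ≤ a := by
    by_contra h
    obtain rfl : a = 1 := by omega
    omega
  obtain rfl | hab := hab.eq_or_lt
  · have := eq_of_smallest_eq ha2 hbc hx hy
    omega
  obtain rfl | ha3 := ha2.eq_or_lt
  · have := eq_of_smallest_eq_two hab hbc hx hy hz
    omega
  · have := eq_of_three_le_smallest ha3 hab hbc hx hy hz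
    omega

theorem Multiset.pair_eq_pair {α : Type*} {a b p q : α}
    (h : ({a, b} : Multiset α) = {p, q}) : (a = p ∧ b = q) ∨ (a = q ∧ b = p) := by
  have ha : a ∈ ({p, q} : Multiset α) := h ▸ Multiset.mem_cons_self a {b}
  have ha' : a = p ∨ a = q := by simpa using ha
  rcases ha' with rfl | rfl
  · exact .inl ⟨rfl, Multiset.singleton_inj.1 ((Multiset.cons_inj_right a).1 h)⟩
  · rw [Multiset.pair_comm p a] at h
    exact .inr ⟨rfl, Multiset.singleton_inj.1 ((Multiset.cons_inj_right a).1 h)⟩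

theorem Multiset.triple_eq_triple {α : Type*} {a b c p q r : α}
    (h : ({a, b, c} : Multiset α) = {p, q, r}) :
    (a = p ∧ b = q ∧ c = r) ∨ (a = p ∧ b = r ∧ c = q) ∨
      (a = q ∧ b = p ∧ c = r) ∨ (a = q ∧ b = r ∧ c = p) ∨
      (a = r ∧ b = p ∧ c = q) ∨ (a = r ∧ b = q ∧ c = p) := by
  have ha : a ∈ ({p, q, r} : Multiset α) := h ▸ Multiset.mem_cons_self a {b, c}
  have ha' : a = p ∨ a = q ∨ a = r := by simpa using ha
  rcases ha' with rfl | rfl | rfl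
  · have := Multiset.pair_eq_pair ((Multiset.cons_inj_right a).1 h)
    tauto
  · have h' : ({p, a, r} : Multiset α) = {a, p, r} := Multiset.cons_swap p a {r}
    have := Multiset.pair_eq_pair ((Multiset.cons_inj_right a).1 (h.trans h'))
    tauto
  · have h' : ({p, q, a} : Multiset α) = {a, p, q} := by
      rw [Multiset.pair_comm q a]
      exact Multiset.cons_swap p a {q}
    have := Multiset.pair_eq_pair ((Multiset.cons_inj_right a).1 (h.trans h'))
    tauto

/-- IMO 2015 Problem 2, as a complete classification: positive integers `a, b, c`
satisfy the inequalities and the power-of-2 conditions iff `(a, b, c)` is a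
permutation of `(2,2,2)`, `(3,2,2)`, `(11,6,2)`, or `(7,5,3)`. Permutation is
expressed as equality of multisets. -/
theorem imo2015_p2 (a b c : ℕ) :
    (0 < a ∧ 0 < b ∧ 0 < c ∧
      c < a * b ∧ a < b * c ∧ b < c * a ∧
      IsPow2 (a * b - c) ∧ IsPow2 (b * c - a) ∧ IsPow2 (c * a - b)) ↔
    (({a, b, c} : Multiset ℕ) = {2, 2, 2} ∨
     ({a, b, c} : Multiset ℕ) = {3, 2, 2} ∨
     ({a, b, c} : Multiset ℕ) = {11, 6, 2} ∨
     ({a, b, c} : Multiset ℕ) = {7, 5, 3}) := by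
  constructor
  · rintro ⟨ha, hb, hc, hcab, habc, hbca, ⟨x, hx⟩, ⟨z, hz⟩, ⟨y, hy⟩⟩
    have hx : a * b = c + 2 ^ x := by omega
    have hy : c * a = b + 2 ^ y := by omega
    have hz : b * c = a + 2 ^ z := by omega
    have hx' := (mul_comm b a).trans hx
    have hy' := (mul_comm a c).trans hy
    have hz' := (mul_comm c b).trans hz
    rcases le_total a b with hab | hab <;> rcases le_total b c with hbc | hbc <;>
      rcases le_total a c with hac | hac
    · rcases eq_of_sorted ha hab hbc hx hy hz with h | h | h | h <;>
        obtain ⟨rfl, rfl, rfl⟩ := h <;> decide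
    · rcases eq_of_sorted ha hab hbc hx hy hz with h | h | h | h <;>
        obtain ⟨rfl, rfl, rfl⟩ := h <;> decide
    · rcases eq_of_sorted ha hac hbc hy' hx' hz' with h | h | h | h <;>
        obtain ⟨rfl, rfl, rfl⟩ := h <;> decide
    · rcases eq_of_sorted hc hac hab hy hz hx with h | h | h | h <;>
        obtain ⟨rfl, rfl, rfl⟩ := h <;> decide
    · rcases eq_of_sorted hb hab hac hx' hz' hy' with h | h | h | h <;>
        obtain ⟨rfl, rfl, rfl⟩ := h <;> decide
    · rcases eq_of_sorted hb hbc hac hz hx hy with h | h | h | h <;>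
        obtain ⟨rfl, rfl, rfl⟩ := h <;> decide
    · rcases eq_of_sorted hc hbc hab hz' hy' hx' with h | h | h | h <;>
        obtain ⟨rfl, rfl, rfl⟩ := h <;> decide
    · rcases eq_of_sorted hc hbc hab hz' hy' hx' with h | h | h | h <;>
        obtain ⟨rfl, rfl, rfl⟩ := h <;> decide
  · rintro (h | h | h | h) <;>
      obtain h | h | h | h | h | h := Multiset.triple_eq_triple h <;>
      obtain ⟨rfl, rfl, rfl⟩ := h <;>
      refine ⟨by norm_num, by norm_num, by norm_num, by norm_num, by norm_num, by norm_num,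
        ?_, ?_, ?_⟩ <;>
      first
      | exact ⟨0, rfl⟩
      | exact ⟨1, rfl⟩
      | exact ⟨2, rfl⟩
      | exact ⟨3, rfl⟩
      | exact ⟨4, rfl⟩
      | exact ⟨5, rfl⟩
      | exact ⟨6, rfl⟩
end

section
/- Let a and c be natural numbers with a ≥ 2 and c ≥ 2 such that c < a*a, and such that both a*a - c and a*c - a are powers of 2 (of the form 2^k with k ≥ 0). Then (a, c) = (2, 2) or (a, c) = (2, 3). -/
/-- The case `a = b` of IMO 2015 Problem 2: the only solutions are
`(a, c) = (2, 2)` and `(a, c) = (2, 3)`. -/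
theorem case_a_eq_b (a c : ℕ) (ha : 2 ≤ a) (hc : 2 ≤ c) (hca : c < a * a)
    (h1 : IsPow2 (a * a - c)) (h2 : IsPow2 (a * c - a)) :
    (a = 2 ∧ c = 2) ∨ (a = 2 ∧ c = 3) := by
  obtain ⟨j, hj⟩ := h1
  obtain ⟨k, hk⟩ := h2
  obtain ⟨d, rfl⟩ : ∃ d, c = d + 1 := ⟨c - 1, by omega⟩
  have had : a * d = 2 ^ k := by rw [← hk, mul_add, mul_one, Nat.add_sub_cancel]
  obtain ⟨m, -, rfl⟩ := (Nat.dvd_prime_pow Nat.prime_two).1 (Dvd.intro _ had)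
  obtain ⟨n, -, rfl⟩ := (Nat.dvd_prime_pow Nat.prime_two).1 (Dvd.intro_left _ had)
  have key : 2 ^ m * 2 ^ m = 2 ^ n + 1 + 2 ^ j := by omega
  obtain _ | m := m
  · norm_num at ha
  have hsq : 2 ^ (m + 1) * 2 ^ (m + 1) = 4 * (2 ^ m * 2 ^ m) := by ring
  rw [hsq] at key
  obtain ⟨hq, hn⟩ : 2 ^ m * 2 ^ m = 1 ∧ (n = 0 ∨ n = 1) := by
    generalize 2 ^ m * 2 ^ m = q at key
    obtain _ | _ | n := n <;> obtain _ | _ | j := j <;>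
      simp only [pow_succ, pow_zero] at key <;> omega
  have ha2 : 2 ^ (m + 1) = 2 := by
    rw [pow_succ, Nat.eq_one_of_mul_eq_one_right hq, one_mul]
  obtain rfl | rfl := hn <;> simp [ha2]
end

section
/- Let a, b, c be natural numbers with 1 < c, c < b, and b < a, such that a < b*c and each of a*b - c, b*c - a, c*a - b is a power of 2 (of the form 2^k with k ≥ 0). Then b*c - a < c*a - b, c*a - b < a*b - c, and moreover (b*c - a) divides (c*a - b), (c*a - b) divides (a*b - c), and (b*c - a) divides (a*b - c). -/
theorem IsPow2.dvd_of_le {x y : ℕ} (hx : IsPow2 x) (hy : IsPow2 y) (h : x ≤ y) : x ∣ y := by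
  obtain ⟨i, rfl⟩ := hx
  obtain ⟨j, rfl⟩ := hy
  exact pow_dvd_pow 2 ((Nat.pow_le_pow_iff_right one_lt_two).mp h)

/-- With `m = a*b - c`, `n = b*c - a`, `p = c*a - b`, one has `n < p < m`
and `n ∣ p`, `p ∣ m`, `n ∣ m`. -/
theorem n_lt_p_lt_m_and_dvd (a b c : ℕ) (hc : 1 < c) (hcb : c < b) (hba : b < a)
    (habc : a < b * c)
    (hm : IsPow2 (a * b - c)) (hn : IsPow2 (b * c - a)) (hp : IsPow2 (c * a - b)) :
    b * c - a < c * a - b ∧ c * a - b < a * b - c ∧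
    (b * c - a) ∣ (c * a - b) ∧ (c * a - b) ∣ (a * b - c) ∧
    (b * c - a) ∣ (a * b - c) := by
  have hb : b ≤ c * a := by nlinarith
  have hc' : c ≤ a * b := by nlinarith
  have hnp : b * c - a < c * a - b := by
    zify [habc.le, hb] at *
    nlinarith [mul_pos (sub_pos.mpr hba) (by linarith : (0 : ℤ) < c + 1)]
  have hpm : c * a - b < a * b - c := by
    zify [hc', hb] at *
    nlinarith [mul_pos (sub_pos.mpr hcb) (by linarith : (0 : ℤ) < a + 1)]
  exact ⟨hnp, hpm, hn.dvd_of_le hp hnp.le, hp.dvd_of_le hm hpm.le,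
    hn.dvd_of_le hm (hnp.trans hpm).le⟩
end

section
/- Let a, b, c be natural numbers with 1 < c, c < b, and b < a, such that a < b*c and each of a*b - c, b*c - a, c*a - b is a power of 2 (of the form 2^k with k ≥ 0). Then c*a - b ≤ 2*(b + c). -/
theorem two_pow_dvd_of_dvd_odd_mul {k t y : ℕ} (h : 2 ^ k ∣ (2 * t + 1) * y) : 2 ^ k ∣ y :=
  (Nat.Coprime.pow_left k ((Nat.coprime_two_left).2 ⟨t, rfl⟩)).dvd_of_dvd_mul_left h

/-- The key bound `p ≤ 2*(b + c)` in the paper's solution of IMO 2015 Problem 2. -/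
theorem p_le_two_mul_add (a b c : ℕ) (hc : 1 < c) (hcb : c < b) (hba : b < a)
    (habc : a < b * c)
    (hm : IsPow2 (a * b - c)) (hn : IsPow2 (b * c - a)) (hp : IsPow2 (c * a - b)) :
    c * a - b ≤ 2 * (b + c) := by
  obtain ⟨i, hi⟩ := hm
  obtain ⟨k, hk⟩ := hp
  obtain ⟨d, rfl⟩ := Nat.exists_eq_add_of_lt hcb
  obtain ⟨e, rfl⟩ : ∃ e, a = e + 1 := ⟨a - 1, by omega⟩
  have hm' : (e + 1) * (c + d + 1) = 2 ^ i + c := by have := Nat.two_pow_pos i; omega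
  have hp' : c * (e + 1) = 2 ^ k + (c + d + 1) := by have := Nat.two_pow_pos k; omega
  have hsub : 2 ^ i = 2 ^ k + (e + 2) * (d + 1) := by linarith
  have hadd : 2 ^ i + 2 ^ k = e * (c + d + 1 + c) := by linarith
  have hdvd : 2 ^ k ∣ 2 ^ i :=
    pow_dvd_pow 2 ((Nat.pow_le_pow_iff_right (by norm_num)).1 (hsub ▸ Nat.le_add_right _ _))
  have h₁ : 2 ^ k ∣ (e + 2) * (d + 1) := (Nat.dvd_add_right dvd_rfl).1 (hsub ▸ hdvd)
  have h₂ : 2 ^ k ∣ e * (c + d + 1 + c) := hadd ▸ dvd_add hdvd dvd_rfl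
  rw [hk]
  obtain ⟨t, ht | ht | ht⟩ : ∃ t, e = 2 * t + 1 ∨ e = 2 * (2 * t) ∨ e = 2 * (2 * t + 1) := by
    rcases Nat.even_or_odd' e with ⟨s, rfl | rfl⟩
    · rcases Nat.even_or_odd' s with ⟨t, rfl | rfl⟩
      exacts [⟨t, by simp⟩, ⟨t, by simp⟩]
    · exact ⟨s, by simp⟩
  · have h : 2 ^ k ∣ d + 1 :=
      two_pow_dvd_of_dvd_odd_mul (t := t + 1) (by convert h₁ using 1; rw [ht]; ring)
    have := Nat.le_of_dvd (by omega) h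
    omega
  · have h : 2 ^ k ∣ 2 * (d + 1) :=
      two_pow_dvd_of_dvd_odd_mul (t := t) (by convert h₁ using 1; rw [ht]; ring)
    have := Nat.le_of_dvd (by omega) h
    omega
  · have h : 2 ^ k ∣ 2 * (c + d + 1 + c) :=
      two_pow_dvd_of_dvd_odd_mul (t := t) (by convert h₂ using 1; rw [ht]; ring)
    exact Nat.le_of_dvd (by omega) h
end

section
/- Let a, b, c be natural numbers with 1 < c, c < b, and b < a, such that a < b*c and each of a*b - c, b*c - a, c*a - b is a power of 2 (of the form 2^k with k ≥ 0). Then c < 4, i.e., c = 2 or c = 3. -/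
theorem two_pow_dvd_of_dvd_mul_odd_s10 {q x y : ℕ} (hy : Odd y) (h : 2 ^ q ∣ x * y) : 2 ^ q ∣ x :=
  (Nat.Coprime.pow_left q (Nat.coprime_two_left.mpr hy)).dvd_of_dvd_mul_right h

/-- A power of 2, `2 ^ p`, dividing both `x * (a + 1)` and `y * (a - 1)` divides `2 * x` or
`2 * y`, because `a + 1` and `a - 1` are not both divisible by `4`. -/
theorem two_pow_dvd_two_mul_or {p a x y : ℕ} (hx : 2 ^ p ∣ x * (a + 1))
    (hy : 2 ^ p ∣ y * (a - 1)) : 2 ^ p ∣ 2 * x ∨ 2 ^ p ∣ 2 * y := by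
  rcases Nat.even_or_odd a with ha | ⟨k, rfl⟩
  · exact .inl ((two_pow_dvd_of_dvd_mul_odd_s10 ha.add_one hx).mul_left 2)
  · rcases Nat.even_or_odd k with hk | hk
    · refine .inl (two_pow_dvd_of_dvd_mul_odd_s10 hk.add_one ?_)
      convert hx using 1
      ring
    · refine .inr (two_pow_dvd_of_dvd_mul_odd_s10 hk ?_)
      convert hy using 1
      rw [Nat.add_sub_cancel]
      ring

/-- The reduction step in IMO 2015 Problem 2: the smallest of the three numbers
is less than `4`, i.e. `c = 2` or `c = 3`. -/
theorem c_lt_four (a b c : ℕ) (hc : 1 < c) (hcb : c < b) (hba : b < a)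
    (habc : a < b * c)
    (hm : IsPow2 (a * b - c)) (hn : IsPow2 (b * c - a)) (hp : IsPow2 (c * a - b)) :
    c < 4 ∧ (c = 2 ∨ c = 3) := by
  suffices h : c < 4 by omega
  by_contra! h4
  obtain ⟨m, hm⟩ := hm
  obtain ⟨p, hp⟩ := hp
  have hab : c ≤ a * b := by nlinarith
  have hca : b ≤ c * a := by nlinarith
  have hm' : a * b = 2 ^ m + c := by omega
  have hp' : c * a = 2 ^ p + b := by omega
  have hpm : 2 ^ p ≤ 2 ^ m := by nlinarith
  have hdvd : 2 ^ p ∣ 2 ^ m :=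
    pow_dvd_pow 2 ((Nat.pow_le_pow_iff_right one_lt_two).mp hpm)
  have hsub : 2 ^ p ∣ (b - c) * (a + 1) := by
    have h : (b - c) * (a + 1) = 2 ^ m - 2 ^ p := by
      zify [hcb.le, hpm] at hm' hp' ⊢
      linear_combination hm' - hp'
    exact h ▸ Nat.dvd_sub hdvd dvd_rfl
  have hadd : 2 ^ p ∣ (b + c) * (a - 1) := by
    have h : (b + c) * (a - 1) = 2 ^ m + 2 ^ p := by
      zify [show 1 ≤ a by omega] at hm' hp' ⊢
      linear_combination hm' + hp'
    exact h ▸ dvd_add hdvd dvd_rfl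
  rcases two_pow_dvd_two_mul_or hsub hadd with h | h
  · have := Nat.le_of_dvd (by omega) h
    have : 4 * a ≤ c * a := Nat.mul_le_mul_right a h4
    omega
  · have := Nat.le_of_dvd (by omega) h
    nlinarith
end

section
/- Let a and b be natural numbers with 2 < b and b < a, such that a < 2*b and each of a*b - 2, 2*a - b, 2*b - a is a power of 2 (of the form 2^k with k ≥ 0). Then a = 11 and b = 6. -/
/-- A power of 2 exceeding `2^j` is divisible by `2^(j+1)`. -/
lemma two_pow_succ_dvd_of_lt {j k : ℕ} (h : 2 ^ j < 2 ^ k) : 2 ^ (j + 1) ∣ 2 ^ k :=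
  pow_dvd_pow 2 ((Nat.pow_lt_pow_iff_right (by norm_num)).1 h)

/-- The case `c = 2` of IMO 2015 Problem 2: the only solution with `2 < b < a`
is `(a, b) = (11, 6)`. -/
theorem case_c_eq_two (a b : ℕ) (hb : 2 < b) (hba : b < a) (hab : a < 2 * b)
    (h1 : IsPow2 (a * b - 2)) (h2 : IsPow2 (2 * a - b)) (h3 : IsPow2 (2 * b - a)) :
    a = 11 ∧ b = 6 := by
  obtain ⟨k, hk⟩ := h1
  obtain ⟨m, hm⟩ := h2
  obtain ⟨n, hn⟩ := h3
  have hprod : 4 * 3 ≤ a * b := Nat.mul_le_mul (by omega) hb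
  have hk16 : 2 ^ 4 ∣ 2 ^ k := two_pow_succ_dvd_of_lt (j := 3) (by omega)
  have hm4 : 2 ^ 2 ∣ 2 ^ m := two_pow_succ_dvd_of_lt (j := 1) (by omega)
  have hn0 : n = 0 := by
    by_contra h0
    have hn2 : 2 ∣ 2 ^ n := dvd_pow_self 2 h0
    have h4 : 2 * 2 ∣ a * b := Nat.mul_dvd_mul (by omega) (by omega)
    omega
  subst hn0
  obtain rfl : a = 2 * b - 1 := by omega
  have key : 2 ^ m * (2 * 2 ^ m + 5) = 9 * 2 ^ k + 16 := by
    have hb3 : 2 ^ m + 2 = 3 * b := by omega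
    have ha3 : 2 * 2 ^ m + 1 = 3 * (2 * b - 1) := by omega
    have hab2 : (2 * b - 1) * b = 2 ^ k + 2 := by omega
    have hmul : (2 * 2 ^ m + 1) * (2 ^ m + 2) = 9 * (2 ^ k + 2) := by
      rw [ha3, hb3, ← hab2]; ring
    linarith
  have hm16 : 2 ^ 4 ∣ 2 ^ m := by
    have hcop : Nat.Coprime (2 ^ 4) (2 * 2 ^ m + 5) :=
      Nat.Coprime.pow_left 4 (Nat.coprime_two_left.2 ⟨2 ^ m + 2, by ring⟩)
    exact hcop.dvd_of_dvd_mul_right (key ▸ by omega)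
  have hm_le : 2 ^ m ≤ 2 ^ 4 := by
    by_contra! hlt
    have hm32 : 2 ^ 5 ∣ 2 ^ m * (2 * 2 ^ m + 5) :=
      (two_pow_succ_dvd_of_lt hlt).mul_right _
    have hk_le : 2 ^ k ≤ 2 ^ 4 := by
      by_contra! hlt'
      have hk32 := two_pow_succ_dvd_of_lt hlt'
      omega
    nlinarith
  have hpos : 0 < 2 ^ m := by positivity
  omega
end

section
/- Let a and b be natural numbers with 3 < b and b < a, such that a < 3*b and each of a*b - 3, 3*a - b, 3*b - a is a power of 2 (of the form 2^k with k ≥ 0). Then a = 7 and b = 5. -/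
/-- The case `c = 3` of IMO 2015 Problem 2: the only solution with `3 < b < a`
is `(a, b) = (7, 5)`. -/
theorem case_c_eq_three (a b : ℕ) (hb : 3 < b) (hba : b < a) (hab : a < 3 * b)
    (h1 : IsPow2 (a * b - 3)) (h2 : IsPow2 (3 * a - b)) (h3 : IsPow2 (3 * b - a)) :
    a = 7 ∧ b = 5 := by
  obtain ⟨k, hk⟩ := h1
  obtain ⟨m, hm⟩ := h2
  obtain ⟨n, hn⟩ := h3
  have hprod : 20 ≤ a * b := by nlinarith
  have hodd : a * b % 2 = 1 := by
    rcases k with _ | k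
    · simp at hk
      omega
    · rw [pow_succ] at hk
      omega
  have hbodd : b % 2 = 1 := (Nat.odd_mul.mp (Nat.odd_iff.mpr hodd)).2 |> Nat.odd_iff.mp
  have hnm : n < m := by
    rw [← Nat.pow_lt_pow_iff_right (a := 2) (by norm_num), ← hm, ← hn]
    omega
  obtain ⟨d, rfl⟩ := Nat.exists_eq_add_of_lt hnm
  have h8 : 8 * b = 2 ^ n * (2 * 2 ^ d + 3) := by
    have : 2 ^ (n + d + 1) = 2 ^ n * (2 * 2 ^ d) := by ring
    rw [mul_add, ← this, ← hm, ← hn]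
    omega
  have hn3 : n = 3 := by
    rcases lt_or_ge n 4 with h | h
    · interval_cases n <;> omega
    · obtain ⟨e, rfl⟩ := Nat.exists_eq_add_of_le h
      rw [pow_add, mul_assoc] at h8
      omega
  subst hn3
  obtain ⟨c, rfl⟩ := Nat.exists_eq_add_of_le hb.le
  obtain rfl : a = 3 * c + 1 := by omega
  have hfac : (3 * c + 10) * c = 2 ^ k := by
    rw [← hk]
    apply Nat.eq_sub_of_add_eq
    ring
  obtain ⟨s, -, hs⟩ := (Nat.dvd_prime_pow Nat.prime_two).mp (Dvd.intro_left _ hfac)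
  obtain ⟨t, -, ht⟩ := (Nat.dvd_prime_pow Nat.prime_two).mp (Dvd.intro _ hfac)
  rcases s with _ | _ | s
  · omega
  · omega
  · rcases t with _ | _ | t
    · omega
    · omega
    · rw [pow_succ, pow_succ] at hs ht
      omega
end

section
/- Let M be a PA⁻ structure equipped with three further binary operations κ, μ, ν satisfying, for all m, n in M: m = κ(m,n)·μ(m,n), n = κ(m,n)·ν(m,n), and (μ(m,n) is odd or ν(m,n) is odd), where an element x is called odd if x = (1+1)·q + 1 for some q in M. Then every element of M is even or odd: for every x in M there exists q in M with x = (1+1)·q or x = (1+1)·q + 1. -/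
/-- A PA⁻ structure: a set with `+`, `·`, `−`, `<`, `0`, `1` satisfying
axioms A1–A15 of the paper. -/
structure PAMinus (M : Type*) where
  add : M → M → M
  mul : M → M → M
  sub : M → M → M
  lt : M → M → Prop
  zero : M
  one : M
  /-- A1: `(x+y)+z = x+(y+z)` -/
  add_assoc : ∀ x y z, add (add x y) z = add x (add y z)
  /-- A2: `x+y = y+x` -/
  add_comm : ∀ x y, add x y = add y x
  /-- A3: `(x·y)·z = x·(y·z)` -/
  mul_assoc : ∀ x y z, mul (mul x y) z = mul x (mul y z)
  /-- A4: `x·y = y·x` -/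
  mul_comm : ∀ x y, mul x y = mul y x
  /-- A5: `x·(y+z) = x·y + x·z` -/
  left_distrib : ∀ x y z, mul x (add y z) = add (mul x y) (mul x z)
  /-- A6: `x+0 = x ∧ x·0 = 0` -/
  add_zero : ∀ x, add x zero = x
  mul_zero : ∀ x, mul x zero = zero
  /-- A7: `x·1 = x` -/
  mul_one : ∀ x, mul x one = x
  /-- A8: transitivity of `<` -/
  lt_trans : ∀ x y z, lt x y → lt y z → lt x z
  /-- A9: irreflexivity of `<` -/
  lt_irrefl : ∀ x, ¬ lt x x
  /-- A10: totality -/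
  lt_total : ∀ x y, lt x y ∨ x = y ∨ lt y x
  /-- A11: `x<y → x+z < y+z` -/
  add_lt_add : ∀ x y z, lt x y → lt (add x z) (add y z)
  /-- A12: `(0<z ∧ x<y) → x·z < y·z` -/
  mul_lt_mul : ∀ x y z, lt zero z → lt x y → lt (mul x z) (mul y z)
  /-- A13: `x<y → x+(y−x) = y` -/
  sub_add : ∀ x y, lt x y → add x (sub y x) = y
  /-- A14: `0<1 ∧ (x>0 → (x>1 ∨ x=1))` -/
  zero_lt_one : lt zero one
  discrete : ∀ x, lt zero x → (lt one x ∨ x = one)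
  /-- A15: `x>0 ∨ x=0` -/
  nonneg : ∀ x, lt zero x ∨ x = zero

/-- A PA⁻ structure equipped with the lowest-terms operations `κ`, `μ`, `ν`
of axiom A17 of Pythagorean Arithmetic: for all `m, n`, `m = κ(m,n)·μ(m,n)`,
`n = κ(m,n)·ν(m,n)`, and `μ(m,n)` or `ν(m,n)` is odd. -/
structure PythKMN (M : Type*) extends PAMinus M where
  kappa : M → M → M
  mu : M → M → M
  nu : M → M → M
  kappa_mu : ∀ m n, m = mul (kappa m n) (mu m n)
  kappa_nu : ∀ m n, n = mul (kappa m n) (nu m n)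
  mu_or_nu_odd : ∀ m n,
    (∃ q, mu m n = add (mul (add one one) q) one) ∨
    (∃ q, nu m n = add (mul (add one one) q) one)

namespace PAMinus

variable {M : Type*} (P : PAMinus M)

theorem zero_add (x : M) : P.add P.zero x = x := by
  rw [P.add_comm, P.add_zero]

theorem one_mul (x : M) : P.mul P.one x = x := by
  rw [P.mul_comm, P.mul_one]

theorem zero_mul (x : M) : P.mul P.zero x = P.zero := by
  rw [P.mul_comm, P.mul_zero]

theorem two_mul (x : M) : P.mul (P.add P.one P.one) x = P.add x x := by
  rw [P.mul_comm, P.left_distrib, P.mul_one]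

theorem add_right_cancel {x y z : M} (h : P.add x z = P.add y z) : x = y := by
  rcases P.lt_total x y with hlt | heq | hgt
  · exact absurd (h ▸ P.add_lt_add x y z hlt) (P.lt_irrefl _)
  · exact heq
  · exact absurd (h ▸ P.add_lt_add y x z hgt) (P.lt_irrefl _)

theorem not_lt_one_of_pos {x : M} (hx : P.lt P.zero x) : ¬ P.lt x P.one := by
  intro h
  rcases P.discrete x hx with hlt | rfl
  · exact P.lt_irrefl _ (P.lt_trans _ _ _ h hlt)
  · exact P.lt_irrefl _ h

theorem one_lt_two : P.lt P.one (P.add P.one P.one) := by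
  simpa only [P.zero_add] using P.add_lt_add _ _ P.one P.zero_lt_one

theorem two_ne_zero : P.add P.one P.one ≠ P.zero := by
  intro h
  have h12 := P.one_lt_two
  rw [h] at h12
  exact P.lt_irrefl _ (P.lt_trans _ _ _ h12 P.zero_lt_one)

theorem not_lt_two_of_one_lt {x : M} (hx : P.lt P.one x) :
    ¬ P.lt x (P.add P.one P.one) := by
  intro h
  have hsub := P.sub_add _ _ hx
  rcases P.nonneg (P.sub x P.one) with hpos | hzero
  · rcases P.discrete _ hpos with hlt | heq
    · have := P.add_lt_add _ _ P.one hlt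
      rw [P.add_comm (P.sub x P.one), hsub] at this
      exact P.lt_irrefl _ (P.lt_trans _ _ _ h this)
    · rw [heq] at hsub
      exact P.lt_irrefl _ (hsub ▸ h)
  · rw [hzero, P.add_zero] at hsub
    exact P.lt_irrefl _ (hsub ▸ hx)

/-- The element `1 + 1` is not odd. -/
theorem two_ne_two_mul_add_one (q : M) :
    P.add P.one P.one ≠ P.add (P.mul (P.add P.one P.one) q) P.one := by
  intro h
  have hq := P.add_right_cancel h
  rw [P.two_mul] at hq
  rcases P.nonneg q with hpos | rfl
  · have hlt := P.add_lt_add _ _ q hpos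
    rw [P.zero_add, ← hq] at hlt
    exact P.not_lt_one_of_pos hpos hlt
  · rw [P.add_zero] at hq
    exact P.lt_irrefl _ (hq ▸ P.zero_lt_one)

/-- The element `1 + 1` has no proper divisors. -/
theorem eq_one_or_eq_one_of_mul_eq_two {a b : M} (h : P.mul a b = P.add P.one P.one) :
    a = P.one ∨ b = P.one := by
  rcases P.nonneg a with ha | rfl
  · rcases P.nonneg b with hb | rfl
    · rcases P.discrete a ha with ha1 | ha1
      · rcases P.discrete b hb with hb1 | hb1
        · have hlt := P.mul_lt_mul _ _ b hb ha1
          rw [P.one_mul, h] at hlt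
          exact absurd hlt (P.not_lt_two_of_one_lt hb1)
        · exact Or.inr hb1
      · exact Or.inl ha1
    · exact absurd (h.symm.trans (P.mul_zero a)) P.two_ne_zero
  · exact absurd (h.symm.trans (P.zero_mul b)) P.two_ne_zero

end PAMinus

/-- In a PA⁻ structure with the operations `κ`, `μ`, `ν` of A17, every element
is even or odd (i.e. axiom A16 is superfluous in the presence of A17). -/
theorem PythKMN.even_or_odd {M : Type*} (P : PythKMN M) (x : M) :
    ∃ q : M, x = P.mul (P.add P.one P.one) q ∨
      x = P.add (P.mul (P.add P.one P.one) q) P.one := by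
  have hx := P.kappa_mu x (P.add P.one P.one)
  have htwo := P.kappa_nu x (P.add P.one P.one)
  rcases P.eq_one_or_eq_one_of_mul_eq_two htwo.symm with hk | hn
  · rw [hk, P.one_mul] at hx htwo
    rcases P.mu_or_nu_odd x (P.add P.one P.one) with ⟨q, hq⟩ | ⟨q, hq⟩
    · exact ⟨q, Or.inr (hx.trans hq)⟩
    · exact absurd (htwo.trans hq) (P.two_ne_two_mul_add_one q)
  · rw [hn, P.mul_one] at htwo
    rw [← htwo] at hx
    exact ⟨_, Or.inl hx⟩
end
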